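/- (Multivariate q-Vandermonde formula, second version.) Let n ≥ 1 and k ≥ 1 be integers, let q > 0 be real with q ≠ 1, and let x_1,…,x_{k+1} be real numbers. Then [x_1+x_2+⋯+x_{k+1}]_{n,q} = Σ [n; r_1,…,r_k]_q · q^{Σ_{j=1}^{k} r_j(z_j−(n−s_j))} · ∏_{j=1}^{k+1}[x_j]_{r_j,q}, where the sum is over all nonnegative integers r_1,…,r_k with r_1+⋯+r_k ≤ n, s_j = r_1+⋯+r_j, r_{k+1} = n − s_k, z_j = x_{j+1}+x_{j+2}+⋯+x_{k+1} for j = 1,…,k, and q raised to a real exponent denotes the real power. -/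

import Mathlib

open Finset Filter

noncomputable def qNum (q x : ℝ) : ℝ := (1 - q ^ x) / (1 - q)

noncomputable def qFact (q x : ℝ) (r : ℕ) : ℝ :=
  ∏ i ∈ Finset.range r, qNum q (x - i)

noncomputable def qFactorial (q : ℝ) (r : ℕ) : ℝ :=
  ∏ i ∈ Finset.range r, qNum q (i + 1)

noncomputable def qBinom (q x : ℝ) (r : ℕ) : ℝ := qFact q x r / qFactorial q r

noncomputable def qMultinom {k : ℕ} (q x : ℝ) (r : Fin k → ℕ) : ℝ :=
  qFact q x (∑ i, r i) / ∏ i, qFactorial q (r i)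

theorem qNum_add {q : ℝ} (hq0 : 0 < q) (hq1 : q ≠ 1) (x y : ℝ) :
    qNum q (x + y) = qNum q y + q ^ y * qNum q x := by
  have h : 1 - q ≠ 0 := sub_ne_zero.mpr hq1.symm
  unfold qNum
  rw [Real.rpow_add hq0]
  field_simp
  ring

theorem qNum_natCast_add_one_ne_zero {q : ℝ} (hq0 : 0 < q) (hq1 : q ≠ 1) (r : ℕ) :
    qNum q (r + 1) ≠ 0 := by
  refine div_ne_zero (sub_ne_zero.mpr fun h => ?_) (sub_ne_zero.mpr hq1.symm)
  have h' : q ^ (r + 1) = 1 := by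
    rw [← Real.rpow_natCast]
    push_cast
    exact h.symm
  exact hq1 ((pow_eq_one_iff_of_nonneg hq0.le r.succ_ne_zero).mp h')

theorem qFactorial_ne_zero {q : ℝ} (hq0 : 0 < q) (hq1 : q ≠ 1) (r : ℕ) :
    qFactorial q r ≠ 0 :=
  Finset.prod_ne_zero_iff.mpr fun i _ => qNum_natCast_add_one_ne_zero hq0 hq1 i

theorem qFact_add (q x : ℝ) (a b : ℕ) :
    qFact q x (a + b) = qFact q x a * qFact q (x - a) b := by
  unfold qFact
  rw [Finset.prod_range_add]
  congr 1
  refine Finset.prod_congr rfl fun i _ => ?_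
  push_cast
  congr 1
  ring

theorem qFact_succ (q x : ℝ) (r : ℕ) :
    qFact q x (r + 1) = qFact q x r * qNum q (x - r) :=
  Finset.prod_range_succ _ _

theorem qFact_add_one_succ (q x : ℝ) (r : ℕ) :
    qFact q (x + 1) (r + 1) = qNum q (x + 1) * qFact q x r := by
  rw [add_comm r 1, qFact_add]
  simp [qFact]

theorem qBinom_zero_right (q x : ℝ) : qBinom q x 0 = 1 := by
  simp [qBinom, qFact, qFactorial]

theorem qBinom_natCast_succ_self (q : ℝ) (n : ℕ) : qBinom q n (n + 1) = 0 := by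
  simp [qBinom, qFact_succ, qNum]

theorem qBinom_add_one_succ {q : ℝ} (hq0 : 0 < q) (hq1 : q ≠ 1) (x : ℝ) (r : ℕ) :
    qBinom q (x + 1) (r + 1) = q ^ (r + 1) * qBinom q x (r + 1) + qBinom q x r := by
  have h1 := qFactorial_ne_zero hq0 hq1 r
  have h2 := qNum_natCast_add_one_ne_zero hq0 hq1 r
  have h3 : qFactorial q (r + 1) = qFactorial q r * qNum q (r + 1) :=
    Finset.prod_range_succ _ _
  have h4 : qNum q (x + 1) = qNum q (r + 1) + q ^ (r + 1) * qNum q (x - r) := by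
    have h := qNum_add hq0 hq1 (x - r) (r + 1)
    rw [show x - r + ((r : ℝ) + 1) = x + 1 by ring] at h
    rw [h, ← Real.rpow_natCast]
    push_cast
    rfl
  unfold qBinom
  rw [qFact_add_one_succ, qFact_succ, h3, h4]
  field_simp
  ring

/-- The `q`-Vandermonde formula. -/
theorem qFact_add_left {q : ℝ} (hq0 : 0 < q) (hq1 : q ≠ 1) (x y : ℝ) (n : ℕ) :
    qFact q (x + y) n = ∑ a ∈ Finset.range (n + 1),
      qBinom q n a * q ^ ((a : ℝ) * (y - ((n : ℝ) - a))) * (qFact q x a * qFact q y (n - a)) := by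
  induction n with
  | zero => simp [qFact, qBinom, qFactorial]
  | succ n ih =>
    set T : ℕ → ℝ := fun a => q ^ ((a : ℝ) * (y - (((n + 1 : ℕ) : ℝ) - a))) *
      (qFact q x a * qFact q y (n + 1 - a)) with hT
    have hstep : ∀ a ∈ Finset.range (n + 1),
        qBinom q n a * q ^ ((a : ℝ) * (y - ((n : ℝ) - a))) *
          (qFact q x a * qFact q y (n - a)) * qNum q (x + y - n) =
        q ^ a * qBinom q n a * T a + qBinom q n a * T (a + 1) := by
      intro a ha
      have han : a ≤ n := Nat.lt_succ_iff.mp (Finset.mem_range.mp ha)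
      have h1 : qNum q (x + y - n) =
          qNum q (y - (n - a)) + q ^ (y - ((n : ℝ) - a)) * qNum q (x - a) := by
        rw [← qNum_add hq0 hq1]
        congr 1
        ring
      have h2 : q ^ ((a : ℝ) * (y - ((n : ℝ) - a))) =
          q ^ a * q ^ ((a : ℝ) * (y - (((n + 1 : ℕ) : ℝ) - a))) := by
        rw [← Real.rpow_natCast, ← Real.rpow_add hq0]
        congr 1
        push_cast
        ring
      have h3 : q ^ (((a + 1 : ℕ) : ℝ) * (y - (((n + 1 : ℕ) : ℝ) - (a + 1 : ℕ)))) =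
          q ^ ((a : ℝ) * (y - ((n : ℝ) - a))) * q ^ (y - ((n : ℝ) - a)) := by
        rw [← Real.rpow_add hq0]
        congr 1
        push_cast
        ring
      have h4 : qFact q y (n + 1 - a) = qFact q y (n - a) * qNum q (y - (n - a)) := by
        rw [Nat.succ_sub han, qFact_succ, Nat.cast_sub han]
      simp only [hT]
      rw [h3, h4, Nat.add_sub_add_right, qFact_succ, h1, mul_add]
      congr 1
      · rw [h2]
        ring
      · ring
    have htop : ∑ a ∈ Finset.range (n + 1), q ^ a * qBinom q n a * T a =
        ∑ a ∈ Finset.range (n + 1), q ^ (a + 1) * qBinom q n (a + 1) * T (a + 1) + T 0 := by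
      have h := Finset.sum_range_succ (fun a => q ^ a * qBinom q n a * T a) (n + 1)
      rw [Finset.sum_range_succ'] at h
      simpa [qBinom_natCast_succ_self, qBinom_zero_right] using h.symm
    rw [qFact_succ, ih, Finset.sum_mul, Finset.sum_congr rfl hstep, Finset.sum_add_distrib, htop]
    simp only [mul_assoc (qBinom _ _ _)]
    change _ = ∑ a ∈ Finset.range (n + 1 + 1), qBinom q (n + 1 : ℕ) a * T a
    rw [Finset.sum_range_succ' _ (n + 1), qBinom_zero_right, one_mul, add_right_comm,
      ← Finset.sum_add_distrib]
    congr 1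
    refine Finset.sum_congr rfl fun a _ => ?_
    rw [Nat.cast_succ, qBinom_add_one_succ hq0 hq1]
    ring

theorem qMultinom_cons {k : ℕ} (q x : ℝ) (a : ℕ) (r : Fin k → ℕ) :
    qMultinom q x (Fin.cons a r : Fin (k + 1) → ℕ) = qBinom q x a * qMultinom q (x - a) r := by
  simp only [qMultinom, qBinom, Fin.sum_univ_succ, Fin.prod_univ_succ, Fin.cons_zero,
    Fin.cons_succ, qFact_add]
  rw [mul_div_mul_comm]

/-- A sum over tuples of total at most `n`, split according to the first entry. -/
theorem sum_filter_sum_le_succ {M : Type*} [AddCommMonoid M] (n k : ℕ)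
    (f : (Fin (k + 1) → ℕ) → M) :
    ∑ r ∈ (Fintype.piFinset fun _ : Fin (k + 1) => Finset.range (n + 1)).filter
        (fun r => ∑ i, r i ≤ n), f r =
      ∑ a ∈ Finset.range (n + 1),
        ∑ r ∈ (Fintype.piFinset fun _ : Fin k => Finset.range (n - a + 1)).filter
          (fun r => ∑ i, r i ≤ n - a), f (Fin.cons a r) := by
  rw [Finset.sum_sigma']
  refine Finset.sum_bij' (fun r _ => ⟨r 0, Fin.tail r⟩) (fun p _ => Fin.cons p.1 p.2)
    ?_ ?_ ?_ ?_ ?_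
  · intro r hr
    simp only [Finset.mem_filter, Fintype.mem_piFinset, Finset.mem_range, Finset.mem_sigma,
      Fin.sum_univ_succ, Fin.tail] at hr ⊢
    refine ⟨hr.1 0, fun i => ?_, by omega⟩
    have := Finset.single_le_sum (f := fun i : Fin k => r i.succ) (fun _ _ => Nat.zero_le _)
      (Finset.mem_univ i)
    omega
  · rintro ⟨a, r⟩ hr
    simp only [Finset.mem_filter, Fintype.mem_piFinset, Finset.mem_range, Finset.mem_sigma,
      Fin.sum_univ_succ, Fin.cons_zero, Fin.cons_succ, Fin.forall_fin_succ] at hr ⊢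
    refine ⟨⟨hr.1, fun i => ?_⟩, by omega⟩
    have := hr.2.1 i
    omega
  · intro r _
    exact Fin.cons_self_tail r
  · rintro ⟨a, r⟩ _
    simp
  · intro r _
    simp

theorem sum_filter_val_lt_succ {M : Type*} [AddCommMonoid M] {k : ℕ} (j : ℕ)
    (x : Fin (k + 1) → M) :
    ∑ i ∈ Finset.univ.filter (fun i : Fin (k + 1) => j + 1 < (i : ℕ)), x i =
      ∑ i ∈ Finset.univ.filter (fun i : Fin k => j < (i : ℕ)), x i.succ := by
  simp [Finset.sum_filter, Fin.sum_univ_succ]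

theorem sum_filter_zero_lt_val {M : Type*} [AddCommMonoid M] {k : ℕ} (x : Fin (k + 2) → M) :
    ∑ i ∈ Finset.univ.filter (fun i : Fin (k + 2) => ((0 : Fin (k + 1)) : ℕ) < (i : ℕ)), x i =
      ∑ i : Fin (k + 1), x i.succ := by
  simp [Finset.sum_filter, Fin.sum_univ_succ]

theorem sum_filter_val_le_succ {M : Type*} [AddCommMonoid M] {k : ℕ} (j : ℕ)
    (x : Fin (k + 1) → M) :
    ∑ i ∈ Finset.univ.filter (fun i : Fin (k + 1) => (i : ℕ) ≤ j + 1), x i =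
      x 0 + ∑ i ∈ Finset.univ.filter (fun i : Fin k => (i : ℕ) ≤ j), x i.succ := by
  simp [Finset.sum_filter, Fin.sum_univ_succ]

theorem sum_filter_val_le_zero {M : Type*} [AddCommMonoid M] {k : ℕ} (x : Fin (k + 1) → M) :
    ∑ i ∈ Finset.univ.filter (fun i : Fin (k + 1) => (i : ℕ) ≤ ((0 : Fin (k + 1)) : ℕ)), x i =
      x 0 := by
  simp [Finset.sum_filter]

theorem qFact_sum {q : ℝ} (hq0 : 0 < q) (hq1 : q ≠ 1) (n k : ℕ) (x : Fin (k + 1) → ℝ) :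
    qFact q (∑ j, x j) n =
      ∑ r ∈ (Fintype.piFinset fun _ : Fin k => Finset.range (n + 1)).filter
          (fun r => ∑ i, r i ≤ n),
        qMultinom q (n : ℝ) r *
          q ^ (∑ j : Fin k,
                (r j : ℝ) *
                  ((∑ i ∈ Finset.univ.filter (fun i : Fin (k + 1) => (j : ℕ) < (i : ℕ)), x i) -
                    ((n : ℝ) -
                      ∑ i ∈ Finset.univ.filter (fun i : Fin k => (i : ℕ) ≤ (j : ℕ)), (r i : ℝ)))) *
          ((∏ j : Fin k, qFact q (x j.castSucc) (r j)) *
            qFact q (x (Fin.last k)) (n - ∑ i, r i)) := by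
  induction k generalizing n with
  | zero => simp [qMultinom, qFact]
  | succ k ih =>
    rw [Fin.sum_univ_succ, qFact_add_left hq0 hq1, sum_filter_sum_le_succ]
    refine Finset.sum_congr rfl fun a ha => ?_
    have han : a ≤ n := Nat.lt_succ_iff.mp (Finset.mem_range.mp ha)
    rw [ih (n - a) fun i => x i.succ, Finset.mul_sum, Finset.mul_sum]
    refine Finset.sum_congr rfl fun r _ => ?_
    rw [qMultinom_cons]
    simp only [Fin.sum_univ_succ (n := k), Fin.prod_univ_succ (n := k), Fin.cons_zero,
      Fin.cons_succ, Fin.val_succ, sum_filter_val_lt_succ, sum_filter_zero_lt_val,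
      sum_filter_val_le_succ, sum_filter_val_le_zero, Real.rpow_add hq0, Nat.cast_sub han,
      Nat.sub_sub, sub_sub, Fin.castSucc_zero, Fin.succ_castSucc, Fin.succ_last]
    ring

/-- Multivariate `q`-Vandermonde formula, second version (2.8):
`[x₁+⋯+x_{k+1}]_{n,q} = ∑ [n; r₁,…,r_k]_q q^{∑_{j=1}^{k} r_j(z_j−(n−s_j))} ∏_{j=1}^{k+1}[x_j]_{r_j,q}`,
summed over nonnegative integers `r₁,…,r_k` with `r₁+⋯+r_k ≤ n`, where `s_j = r₁+⋯+r_j`,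
`r_{k+1} = n − s_k` and `z_j = x_{j+1}+⋯+x_{k+1}`. -/
theorem multivariate_qVandermonde_second
    (n k : ℕ) (hn : 1 ≤ n) (hk : 1 ≤ k)
    (q : ℝ) (hq0 : 0 < q) (hq1 : q ≠ 1) (x : Fin (k + 1) → ℝ) :
    qFact q (∑ j, x j) n =
      ∑ r ∈ (Fintype.piFinset fun _ : Fin k => Finset.range (n + 1)).filter
          (fun r => ∑ i, r i ≤ n),
        qMultinom q (n : ℝ) r *
          q ^ (∑ j : Fin k,
                (r j : ℝ) *
                  ((∑ i ∈ Finset.univ.filter (fun i : Fin (k + 1) => (j : ℕ) < (i : ℕ)), x i) -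
                    ((n : ℝ) -
                      ∑ i ∈ Finset.univ.filter (fun i : Fin k => (i : ℕ) ≤ (j : ℕ)), (r i : ℝ)))) *
          ((∏ j : Fin k, qFact q (x j.castSucc) (r j)) *
            qFact q (x (Fin.last k)) (n - ∑ i, r i)) := by
  exact qFact_sum hq0 hq1 n k x
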